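/- arXiv:2403.03546 — 2 statements merged into one kernel-verified Lean document; each statement's English description precedes it below -/
import Mathlib

section
/- Let T be a subcategory of C. Then T is a tilting subcategory if and only if T is a support τ-tilting subcategory and, for each projective object P, the exact sequence in (ST3) can be chosen so that the left T-approximation f : P → T⁰ is a monomorphism (equivalently, 0 → P → T⁰ → T¹ → 0 is a short exact sequence with T⁰, T¹ ∈ T and P → T⁰ a left T-approximation). -/
open CategoryTheory Category Limits Abelian

universe w v u

variable {C : Type u} [Category.{v} C] [Abelian C]
  [EnoughProjectives C] [EnoughInjectives C] [HasExt.{w} C]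

/-- `f, g` form a short exact sequence `0 → A → B → X → 0`. -/
def IsShortExactSeq {A B X : C} (f : A ⟶ B) (g : B ⟶ X) : Prop :=
  ∃ h : f ≫ g = 0, (ShortComplex.mk f g h).ShortExact

/-- `f, g` form a right exact sequence `A → B → X → 0`
(exact at `B` and at `X`, i.e. `g` is an epimorphism). -/
def IsRightExactSeq {A B X : C} (f : A ⟶ B) (g : B ⟶ X) : Prop :=
  ∃ h : f ≫ g = 0, (ShortComplex.mk f g h).Exact ∧ Epi g

/-- A (full, additive) subcategory, given by its class of objects: closed under
isomorphisms, direct summands and finite direct sums. -/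
def IsSubcat (𝒯 : Set C) : Prop :=
  (∀ ⦃X Y : C⦄, (X ≅ Y) → X ∈ 𝒯 → Y ∈ 𝒯) ∧
  (∀ ⦃X Y : C⦄, (X ⊞ Y) ∈ 𝒯 → X ∈ 𝒯 ∧ Y ∈ 𝒯) ∧
  (∀ ⦃X Y : C⦄, X ∈ 𝒯 → Y ∈ 𝒯 → (X ⊞ Y) ∈ 𝒯)

/-- `𝒯^⊥₁ = {X | Ext¹(T, X) = 0 for all T ∈ 𝒯}`. -/
def rightPerp1 (𝒯 : Set C) : Set C :=
  {X | ∀ T ∈ 𝒯, Subsingleton (Ext T X 1)}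

/-- `^⊥₁𝒱 = {X | Ext¹(X, V) = 0 for all V ∈ 𝒱}`. -/
def leftPerp1 (𝒱 : Set C) : Set C :=
  {X | ∀ V ∈ 𝒱, Subsingleton (Ext X V 1)}

/-- `Defl 𝒯`: objects admitting an epimorphism from an object of `𝒯`. -/
def Defl (𝒯 : Set C) : Set C :=
  {F | ∃ T ∈ 𝒯, ∃ g : T ⟶ F, Epi g}

/-- `𝒰` is a generator of `𝒱`: `𝒰 ⊆ 𝒱` and every `V ∈ 𝒱` fits in a short exact
sequence `0 → V' → U → V → 0` with `U ∈ 𝒰`, `V' ∈ 𝒱`. -/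
def IsGeneratorOf (𝒰 𝒱 : Set C) : Prop :=
  𝒰 ⊆ 𝒱 ∧ ∀ V ∈ 𝒱, ∃ V' ∈ 𝒱, ∃ U ∈ 𝒰, ∃ (f : V' ⟶ U) (g : U ⟶ V), IsShortExactSeq f g

/-- `f : P ⟶ T₀` is a left `𝒯`-approximation of `P`. -/
def IsLeftApprox (𝒯 : Set C) {P T₀ : C} (f : P ⟶ T₀) : Prop :=
  T₀ ∈ 𝒯 ∧ ∀ T ∈ 𝒯, ∀ φ : P ⟶ T, ∃ ψ : T₀ ⟶ T, f ≫ ψ = φ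

/-- `𝒯` is a support `τ`-tilting subcategory. -/
def IsSupportTauTilting (𝒯 : Set C) : Prop :=
  IsGeneratorOf 𝒯 (Defl 𝒯) ∧
  (∀ T ∈ 𝒯, ∀ D ∈ Defl 𝒯, Subsingleton (Ext T D 1)) ∧
  (∀ P : C, Projective P → ∃ T₀ ∈ 𝒯, ∃ T₁ ∈ 𝒯, ∃ (f : P ⟶ T₀) (g : T₀ ⟶ T₁),
    IsRightExactSeq f g ∧ IsLeftApprox 𝒯 f)

/-- `(𝒰, 𝒱)` is a `τ`-cotorsion pair. -/
def IsTauCotorsionPair (𝒰 𝒱 : Set C) : Prop :=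
  𝒰 = leftPerp1 𝒱 ∧
  ∀ P : C, Projective P → ∃ V₀ ∈ 𝒰 ∩ 𝒱, ∃ U₀ ∈ 𝒰, ∃ (f : P ⟶ V₀) (g : V₀ ⟶ U₀),
    IsRightExactSeq f g ∧ IsLeftApprox 𝒱 f

/-- `(𝒰, 𝒱)` is a cotorsion pair (both classes closed under direct summands). -/
def IsCotorsionPair (𝒰 𝒱 : Set C) : Prop :=
  (∀ ⦃X Y : C⦄, (X ⊞ Y) ∈ 𝒰 → X ∈ 𝒰 ∧ Y ∈ 𝒰) ∧
  (∀ ⦃X Y : C⦄, (X ⊞ Y) ∈ 𝒱 → X ∈ 𝒱 ∧ Y ∈ 𝒱) ∧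
  (∀ U ∈ 𝒰, ∀ V ∈ 𝒱, Subsingleton (Ext U V 1)) ∧
  (∀ X : C, ∃ V' ∈ 𝒱, ∃ U' ∈ 𝒰, ∃ (f : V' ⟶ U') (g : U' ⟶ X), IsShortExactSeq f g) ∧
  (∀ X : C, ∃ V' ∈ 𝒱, ∃ U' ∈ 𝒰, ∃ (f : X ⟶ V') (g : V' ⟶ U'), IsShortExactSeq f g)

/-- `𝒱` is a torsion class: closed under extensions and epimorphic images. -/
def IsTorsionClass (𝒱 : Set C) : Prop :=
  (∀ ⦃A B X : C⦄ (f : A ⟶ B) (g : B ⟶ X),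
    IsShortExactSeq f g → A ∈ 𝒱 → X ∈ 𝒱 → B ∈ 𝒱) ∧
  (∀ ⦃A B : C⦄ (g : A ⟶ B), Epi g → A ∈ 𝒱 → B ∈ 𝒱)

set_option linter.unusedSectionVars false

lemma IsShortExactSeq.mono {A B X : C} {f : A ⟶ B} {g : B ⟶ X} (h : IsShortExactSeq f g) :
    Mono f := h.2.mono_f

lemma IsShortExactSeq.epi {A B X : C} {f : A ⟶ B} {g : B ⟶ X} (h : IsShortExactSeq f g) :
    Epi g := h.2.epi_g

lemma isShortExactSeq_cokernel {A B : C} (f : A ⟶ B) [Mono f] :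
    IsShortExactSeq f (cokernel.π f) :=
  ⟨cokernel.condition f, .mk' (ShortComplex.exact_cokernel f) inferInstance inferInstance⟩

lemma isShortExactSeq_kernel {A B : C} (g : A ⟶ B) [Epi g] :
    IsShortExactSeq (kernel.ι g) g :=
  ⟨kernel.condition g, .mk' (ShortComplex.exact_kernel g) inferInstance inferInstance⟩

/-- Maps out of `X` lift along an epimorphism whose kernel `A` has `Ext¹(X, A) = 0`. -/
lemma IsShortExactSeq.exists_lift {A B Z X : C} {f : A ⟶ B} {g : B ⟶ Z}
    (h : IsShortExactSeq f g) (hX : Subsingleton (Ext X A 1)) (φ : X ⟶ Z) :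
    ∃ ψ : X ⟶ B, ψ ≫ g = φ := by
  obtain ⟨x, hx⟩ := Ext.covariant_sequence_exact₃ X h.2 (Ext.mk₀ φ) (zero_add 1)
    (Subsingleton.elim _ _)
  obtain ⟨ψ, rfl⟩ := (Ext.mk₀_bijective _ _).2 x
  exact ⟨ψ, (Ext.mk₀_bijective _ _).1 ((Ext.mk₀_comp_mk₀ _ _).symm.trans hx)⟩

/-- Maps into `Y` extend along a monomorphism whose cokernel `Z` has `Ext¹(Z, Y) = 0`. -/
lemma IsShortExactSeq.exists_extension {A B Z Y : C} {f : A ⟶ B} {g : B ⟶ Z}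
    (h : IsShortExactSeq f g) (hY : Subsingleton (Ext Z Y 1)) (φ : A ⟶ Y) :
    ∃ ψ : B ⟶ Y, f ≫ ψ = φ := by
  obtain ⟨x, hx⟩ := Ext.contravariant_sequence_exact₁ h.2 Y (Ext.mk₀ φ) (add_zero 1)
    (Subsingleton.elim _ _)
  obtain ⟨ψ, rfl⟩ := (Ext.mk₀_bijective _ _).2 x
  exact ⟨ψ, (Ext.mk₀_bijective _ _).1 ((Ext.mk₀_comp_mk₀ _ _).symm.trans hx)⟩

lemma IsShortExactSeq.subsingleton_ext_middle {A B Z : C} {f : A ⟶ B} {g : B ⟶ Z}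
    (h : IsShortExactSeq f g) (X : C) (n : ℕ) (hA : Subsingleton (Ext X A n))
    (hZ : Subsingleton (Ext X Z n)) : Subsingleton (Ext X B n) := by
  refine subsingleton_of_forall_eq 0 fun x => ?_
  obtain ⟨y, rfl⟩ := Ext.covariant_sequence_exact₂ X h.2 x (Subsingleton.elim _ _)
  rw [Subsingleton.elim y 0, Ext.zero_comp]

lemma IsShortExactSeq.subsingleton_ext_middle' {A B Z : C} {f : A ⟶ B} {g : B ⟶ Z}
    (h : IsShortExactSeq f g) (Y : C) (n : ℕ) (hA : Subsingleton (Ext A Y n))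
    (hZ : Subsingleton (Ext Z Y n)) : Subsingleton (Ext B Y n) := by
  refine subsingleton_of_forall_eq 0 fun x => ?_
  obtain ⟨y, rfl⟩ := Ext.contravariant_sequence_exact₂ h.2 Y x (Subsingleton.elim _ _)
  rw [Subsingleton.elim y 0, Ext.comp_zero]

lemma IsShortExactSeq.subsingleton_ext_left {A B Z : C} {f : A ⟶ B} {g : B ⟶ Z}
    (h : IsShortExactSeq f g) (X : C) (n : ℕ) (hZ : Subsingleton (Ext X Z n))
    (hB : Subsingleton (Ext X B (n + 1))) : Subsingleton (Ext X A (n + 1)) := by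
  refine subsingleton_of_forall_eq 0 fun x => ?_
  obtain ⟨y, rfl⟩ := Ext.covariant_sequence_exact₁ X h.2 x (Subsingleton.elim _ _) rfl
  rw [Subsingleton.elim y 0, Ext.zero_comp]

lemma IsShortExactSeq.subsingleton_ext_right {A B Z : C} {f : A ⟶ B} {g : B ⟶ Z}
    (h : IsShortExactSeq f g) (X : C) (n : ℕ) (hB : Subsingleton (Ext X B n))
    (hA : Subsingleton (Ext X A (n + 1))) : Subsingleton (Ext X Z n) := by
  refine subsingleton_of_forall_eq 0 fun x => ?_
  obtain ⟨y, rfl⟩ := Ext.covariant_sequence_exact₃ X h.2 x rfl (Subsingleton.elim _ _)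
  rw [Subsingleton.elim y 0, Ext.zero_comp]

/-- Pulling back a short exact sequence along an arbitrary map. -/
lemma IsShortExactSeq.pullback {A B Z X : C} {f : A ⟶ B} {g : B ⟶ Z}
    (h : IsShortExactSeq f g) (φ : X ⟶ Z) :
    ∃ j : A ⟶ Limits.pullback g φ, IsShortExactSeq j (pullback.snd g φ) := by
  have := h.mono
  have := h.epi
  have w : f ≫ g = (0 : A ⟶ X) ≫ φ := h.1.trans zero_comp.symm
  have hm : Mono (pullback.lift f 0 w) := mono_of_mono_fac (pullback.lift_fst f 0 w)
  refine ⟨pullback.lift f 0 w, pullback.lift_snd f 0 w, ?_⟩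
  refine .mk' (ShortComplex.exact_of_f_is_kernel _
    (KernelFork.IsLimit.ofι' _ _ fun {W} k hk => ?_)) hm inferInstance
  have hk' : (k ≫ pullback.fst g φ) ≫ g = 0 := by
    rw [assoc, pullback.condition, ← assoc]
    exact (congrArg (· ≫ φ) hk).trans zero_comp
  refine ⟨h.2.exact.lift _ hk', ?_⟩
  apply pullback.hom_ext
  · exact (assoc _ _ _).trans ((congrArg _ (pullback.lift_fst f 0 w)).trans
      (h.2.exact.lift_f _ hk'))
  · exact (assoc _ _ _).trans ((congrArg _ (pullback.lift_snd f 0 w)).trans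
      (comp_zero.trans hk.symm))

/-- A subcategory containing the middle term of a split short exact sequence contains its last
term. -/
lemma IsShortExactSeq.mem_of_section {𝒯 : Set C} (h𝒯 : IsSubcat 𝒯) {A B X : C}
    {f : A ⟶ B} {g : B ⟶ X} (h : IsShortExactSeq f g) (s : X ⟶ B) (hs : s ≫ g = 𝟙 X)
    (hB : B ∈ 𝒯) : X ∈ 𝒯 := by
  let σ := ShortComplex.Splitting.ofExactOfSection _ h.2.exact s hs h.mono
  exact (h𝒯.2.1 (h𝒯.1 σ.isoBinaryBiproduct hB)).2

lemma mem_of_isGeneratorOf_rightPerp1 {𝒯 : Set C} (h𝒯 : IsSubcat 𝒯)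
    (hgen : IsGeneratorOf 𝒯 (rightPerp1 𝒯)) {E : C} (hE : E ∈ rightPerp1 𝒯)
    (hE' : E ∈ leftPerp1 (rightPerp1 𝒯)) : E ∈ 𝒯 := by
  obtain ⟨V, hV, U, hU, f, g, h⟩ := hgen.2 E hE
  obtain ⟨s, hs⟩ := h.exists_lift (hE' V hV) (𝟙 E)
  exact h.mem_of_section h𝒯 s hs hU

lemma mem_rightPerp1_of_epi {𝒯 : Set C} (hpd : ∀ T ∈ 𝒯, ∀ X : C, Subsingleton (Ext T X 2))
    {A B : C} (g : A ⟶ B) [Epi g] (hA : A ∈ rightPerp1 𝒯) : B ∈ rightPerp1 𝒯 := fun T hT =>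
  (isShortExactSeq_kernel g).subsingleton_ext_right T 1 (hA T hT) (hpd T hT _)

lemma defl_eq_rightPerp1 {𝒯 : Set C} (hpd : ∀ T ∈ 𝒯, ∀ X : C, Subsingleton (Ext T X 2))
    (hgen : IsGeneratorOf 𝒯 (rightPerp1 𝒯)) : Defl 𝒯 = rightPerp1 𝒯 := by
  ext X
  constructor
  · rintro ⟨T, hT, g, hg⟩
    exact mem_rightPerp1_of_epi hpd g (hgen.1 hT)
  · intro hX
    obtain ⟨V, -, U, hU, f, g, h⟩ := hgen.2 X hX
    exact ⟨U, hU, g, h.epi⟩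

lemma exists_mono_of_projective {𝒯 : Set C} (hgen : IsGeneratorOf 𝒯 (rightPerp1 𝒯))
    (P : C) [Projective P] : ∃ T ∈ 𝒯, ∃ f : P ⟶ T, Mono f := by
  obtain ⟨V, -, T, hT, i, g, h⟩ := hgen.2 (Injective.under P) fun T _ =>
    Ext.subsingleton_of_injective T (Injective.under P) 0
  have := h.epi
  exact ⟨T, hT, Projective.factorThru (Injective.ι P) g,
    mono_of_mono_fac (Projective.factorThru_comp (Injective.ι P) g)⟩

lemma exists_isShortExactSeq_of_projective {𝒯 : Set C} (h𝒯 : IsSubcat 𝒯)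
    (hpd : ∀ T ∈ 𝒯, ∀ X : C, Subsingleton (Ext T X 2))
    (hgen : IsGeneratorOf 𝒯 (rightPerp1 𝒯)) (P : C) [Projective P] :
    ∃ T₀ ∈ 𝒯, ∃ T₁ ∈ 𝒯, ∃ (f : P ⟶ T₀) (g : T₀ ⟶ T₁),
      IsShortExactSeq f g ∧ IsLeftApprox 𝒯 f := by
  obtain ⟨T, hT, f, hf⟩ := exists_mono_of_projective hgen P
  obtain ⟨V, hV, T₁, hT₁, i, q, hq⟩ := hgen.2 _
    (mem_rightPerp1_of_epi hpd (cokernel.π f) (hgen.1 hT))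
  obtain ⟨j, hj⟩ := (isShortExactSeq_cokernel f).pullback q
  obtain ⟨k, hk⟩ := hq.pullback (cokernel.π f)
  have hE : Limits.pullback (cokernel.π f) q ∈ 𝒯 := by
    refine mem_of_isGeneratorOf_rightPerp1 h𝒯 hgen ?_ (fun Y hY => ?_)
    · exact mem_rightPerp1_of_epi hpd (pullbackSymmetry q (cokernel.π f)).hom fun S hS =>
        hk.subsingleton_ext_middle S 1 (hV S hS) (hgen.1 hT S hS)
    · exact hj.subsingleton_ext_middle' Y 1 (Ext.subsingleton_of_projective P Y 0) (hY T₁ hT₁)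
  exact ⟨_, hE, T₁, hT₁, j, _, hj, hE, fun S hS φ => hj.exists_extension (hgen.1 hS T₁ hT₁) φ⟩

lemma isSupportTauTilting_of_isGeneratorOf {𝒯 : Set C} (h𝒯 : IsSubcat 𝒯)
    (hpd : ∀ T ∈ 𝒯, ∀ X : C, Subsingleton (Ext T X 2))
    (hgen : IsGeneratorOf 𝒯 (rightPerp1 𝒯)) : IsSupportTauTilting 𝒯 := by
  have hD := defl_eq_rightPerp1 hpd hgen
  refine ⟨hD ▸ hgen, fun T hT D hD' => (hD ▸ hD' : D ∈ rightPerp1 𝒯) T hT, fun P hP => ?_⟩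
  obtain ⟨T₀, hT₀, T₁, hT₁, f, g, h, hf⟩ :=
    exists_isShortExactSeq_of_projective h𝒯 hpd hgen P
  exact ⟨T₀, hT₀, T₁, hT₁, f, g, ⟨h.1, h.2.exact, h.epi⟩, hf⟩

lemma rightPerp1_subset_defl {𝒯 : Set C}
    (hproj : ∀ P : C, Projective P → ∃ T₀ ∈ 𝒯, ∃ T₁ ∈ 𝒯, ∃ (f : P ⟶ T₀) (g : T₀ ⟶ T₁),
      IsShortExactSeq f g ∧ IsLeftApprox 𝒯 f) :
    rightPerp1 𝒯 ⊆ Defl 𝒯 := by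
  intro X hX
  obtain ⟨T₀, hT₀, T₁, hT₁, f, g, h, -⟩ := hproj (Projective.over X) inferInstance
  obtain ⟨ψ, hψ⟩ := h.exists_extension (hX T₁ hT₁) (Projective.π X)
  exact ⟨T₀, hT₀, ψ, epi_of_epi_fac hψ⟩

lemma subsingleton_ext_two {𝒯 : Set C}
    (hproj : ∀ P : C, Projective P → ∃ T₀ ∈ 𝒯, ∃ T₁ ∈ 𝒯, ∃ (f : P ⟶ T₀) (g : T₀ ⟶ T₁),
      IsShortExactSeq f g ∧ IsLeftApprox 𝒯 f)
    (hext : ∀ T ∈ 𝒯, ∀ D ∈ Defl 𝒯, Subsingleton (Ext T D 1))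
    {T : C} (hT : T ∈ 𝒯) (X : C) : Subsingleton (Ext T X 2) := by
  obtain ⟨S, hS, g, hg⟩ := rightPerp1_subset_defl hproj
    (fun T _ => Ext.subsingleton_of_injective T (Injective.under X) 0)
  exact (isShortExactSeq_cokernel (Injective.ι X)).subsingleton_ext_left T 1
    (hext T hT _ ⟨S, hS, g ≫ cokernel.π _, epi_comp _ _⟩)
    (Ext.subsingleton_of_injective T _ 1)

lemma isGeneratorOf_rightPerp1 {𝒯 : Set C}
    (hproj : ∀ P : C, Projective P → ∃ T₀ ∈ 𝒯, ∃ T₁ ∈ 𝒯, ∃ (f : P ⟶ T₀) (g : T₀ ⟶ T₁),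
      IsShortExactSeq f g ∧ IsLeftApprox 𝒯 f)
    (hgen : IsGeneratorOf 𝒯 (Defl 𝒯))
    (hext : ∀ T ∈ 𝒯, ∀ D ∈ Defl 𝒯, Subsingleton (Ext T D 1)) :
    IsGeneratorOf 𝒯 (rightPerp1 𝒯) := by
  have h : Defl 𝒯 = rightPerp1 𝒯 :=
    Set.Subset.antisymm (fun D hD T hT => hext T hT D hD) (rightPerp1_subset_defl hproj)
  exact h ▸ hgen

theorem stmt_5 (𝒯 : Set C) (h𝒯 : IsSubcat 𝒯) :
    ((∀ T ∈ 𝒯, ∀ X : C, Subsingleton (Ext T X 2)) ∧ IsGeneratorOf 𝒯 (rightPerp1 𝒯)) ↔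
      (IsSupportTauTilting 𝒯 ∧
       ∀ P : C, Projective P → ∃ T₀ ∈ 𝒯, ∃ T₁ ∈ 𝒯, ∃ (f : P ⟶ T₀) (g : T₀ ⟶ T₁),
         IsShortExactSeq f g ∧ IsLeftApprox 𝒯 f) := by
  constructor
  · rintro ⟨hpd, hgen⟩
    exact ⟨isSupportTauTilting_of_isGeneratorOf h𝒯 hpd hgen,
      fun P _ => exists_isShortExactSeq_of_projective h𝒯 hpd hgen P⟩
  · rintro ⟨⟨hgen, hext, -⟩, hproj⟩
    exact ⟨fun T hT X => subsingleton_ext_two hproj hext hT X,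
      isGeneratorOf_rightPerp1 hproj hgen hext⟩
end

section
/- Let T be a support τ-tilting subcategory of C. Then ^⊥₁(Defl(T)) ∩ Defl(T) = T, i.e., an object X lies in T if and only if X ∈ Defl(T) and Ext¹(X,D) = 0 for all D ∈ Defl(T). -/
open CategoryTheory Category Limits Abelian

universe w v u

variable {C : Type u} [Category.{v} C] [Abelian C]
  [EnoughProjectives C] [EnoughInjectives C] [HasExt.{w} C]

/-- A short exact sequence `0 → A → B → X → 0` with `Ext¹(X, A) = 0` splits, so that `B` is
isomorphic to `A ⊞ X`. -/
theorem IsShortExactSeq.nonempty_iso_biprod {A B X : C} {f : A ⟶ B} {g : B ⟶ X}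
    (h : IsShortExactSeq f g) (hExt : Subsingleton (Ext X A 1)) : Nonempty (B ≅ A ⊞ X) := by
  obtain ⟨w, hS⟩ := h
  obtain ⟨x, hx⟩ := Ext.covariant_sequence_exact₃ X hS (Ext.mk₀ (𝟙 X)) (zero_add 1)
    (Subsingleton.elim _ _)
  obtain ⟨s, rfl⟩ := (Ext.mk₀_bijective X B).2 x
  have hs : s ≫ g = 𝟙 X := (Ext.mk₀_bijective X X).1 (by simpa using hx)
  have hf := hS.mono_f
  exact ⟨(ShortComplex.Splitting.ofExactOfSection _ hS.exact s hs hf).isoBinaryBiproduct⟩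

theorem stmt_8 (𝒯 : Set C) (h𝒯 : IsSubcat 𝒯) (hst : IsSupportTauTilting 𝒯) :
    leftPerp1 (Defl 𝒯) ∩ Defl 𝒯 = 𝒯 := by
  obtain ⟨⟨hsub, hgen⟩, hExt, -⟩ := hst
  obtain ⟨hiso, hsummand, -⟩ := h𝒯
  ext X
  refine ⟨fun ⟨hperp, hX⟩ => ?_, fun hX => ⟨hExt X hX, hsub hX⟩⟩
  obtain ⟨V, hV, U, hU, f, g, hfg⟩ := hgen X hX
  obtain ⟨e⟩ := hfg.nonempty_iso_biprod (hperp V hV)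
  exact (hsummand (hiso e hU)).2
end
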